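/- Let S be a finite planar point set in general position whose convex hull is a triangle (exactly 3 points of S are vertices of the convex hull) and which has at least 3 points of S in the interior of its convex hull. Then some 6 points of S form a standard 6-pseudo-triangle whose interior contains no point of S. -/

import Mathlib

open Set

noncomputable section

/-- Points of the plane. -/
abbrev Pt : Type := ℝ × ℝ

/-- Two-dimensional cross product. -/
def cross2 (u w : Pt) : ℝ := u.1 * w.2 - u.2 * w.1

/-- A set of points is in general position if no three of its points are collinear. -/
def GenPos (S : Set Pt) : Prop :=
  ∀ p ∈ S, ∀ q ∈ S, ∀ r ∈ S, p ≠ q → p ≠ r → q ≠ r →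
    ¬ Collinear ℝ ({p, q, r} : Set Pt)

/-- `v : ZMod n → Pt` lists the vertices (in cyclic order) of a simple polygon:
vertices are pairwise distinct, non-adjacent edges are disjoint, and adjacent
edges meet exactly in their common vertex. -/
structure IsSimplePolygon (n : ℕ) (v : ZMod n → Pt) : Prop where
  three_le : 3 ≤ n
  inj : Function.Injective v
  nonadj : ∀ i j : ZMod n, i ≠ j → i ≠ j + 1 → j ≠ i + 1 →
    segment ℝ (v i) (v (i + 1)) ∩ segment ℝ (v j) (v (j + 1)) = ∅
  adj : ∀ i : ZMod n,
    segment ℝ (v i) (v (i + 1)) ∩ segment ℝ (v (i + 1)) (v (i + 2)) = {v (i + 1)}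

/-- Twice the signed area of a polygon. -/
def signedArea (n : ℕ) (v : ZMod n → Pt) : ℝ :=
  if h : n = 0 then 0 else
    haveI : NeZero n := ⟨h⟩
    ∑ i : ZMod n, cross2 (v i) (v (i + 1))

/-- The turning cross product at vertex `i`. -/
def vtxCross (n : ℕ) (v : ZMod n → Pt) (i : ZMod n) : ℝ :=
  cross2 (v i - v (i - 1)) (v (i + 1) - v i)

/-- Vertex `i` of a simple polygon is convex (interior angle `< π`) iff the turn
at `i` has the same (strict) sign as the orientation of the polygon. -/
def IsConvexVtx (n : ℕ) (v : ZMod n → Pt) (i : ZMod n) : Prop :=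
  0 < vtxCross n v i * signedArea n v

/-- A pseudo-triangle: a simple polygon in which every vertex is strictly convex or
strictly reflex, with exactly three convex vertices. -/
def IsPseudoTriangle (n : ℕ) (v : ZMod n → Pt) : Prop :=
  IsSimplePolygon n v ∧ (∀ i : ZMod n, vtxCross n v i ≠ 0) ∧
    {i : ZMod n | IsConvexVtx n v i}.ncard = 3

/-- A standard pseudo-triangle: each of the three side chains has at least two
edges, i.e. no two convex vertices are cyclically adjacent. -/
def IsStandardPseudoTriangle (n : ℕ) (v : ZMod n → Pt) : Prop :=
  IsPseudoTriangle n v ∧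
    ∀ i : ZMod n, IsConvexVtx n v i → ¬ IsConvexVtx n v (i + 1)

/-- A mountain: a pseudo-triangle in which exactly one side chain consists of a
single edge (i.e. exactly one cyclically adjacent pair of convex vertices);
a 3-mountain is a triangle. -/
def IsMountain (n : ℕ) (v : ZMod n → Pt) : Prop :=
  IsPseudoTriangle n v ∧
    (n = 3 ∨ {i : ZMod n | IsConvexVtx n v i ∧ IsConvexVtx n v (i + 1)}.ncard = 1)

/-- The boundary of a polygon: the union of its edges. -/
def polyBoundary (n : ℕ) (v : ZMod n → Pt) : Set Pt :=
  ⋃ i : ZMod n, segment ℝ (v i) (v (i + 1))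

/-- The interior of a simple polygon: the union of the bounded connected
components of the complement of its boundary. -/
def polyInterior (n : ℕ) (v : ZMod n → Pt) : Set Pt :=
  {x : Pt | x ∉ polyBoundary n v ∧
    Bornology.IsBounded (connectedComponentIn (polyBoundary n v)ᶜ x)}

/-- A polygon is empty in `S` if its interior contains no point of `S`. -/
def EmptyIn (n : ℕ) (v : ZMod n → Pt) (S : Set Pt) : Prop :=
  polyInterior n v ∩ S = ∅

/-- `S` contains an empty `ℓ`-pseudo-triangle. -/
def HasEmptyPseudoTriangle (ℓ : ℕ) (S : Set Pt) : Prop :=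
  ∃ v : ZMod ℓ → Pt, Set.range v ⊆ S ∧ IsPseudoTriangle ℓ v ∧ EmptyIn ℓ v S

/-- A set of points is in convex position if each of them is a vertex of their
convex hull. -/
def ConvexPos (H : Set Pt) : Prop := ∀ p ∈ H, p ∉ convexHull ℝ (H \ {p})

/-- `H` is a `k`-hole in `S`: `k` points of `S` in convex position whose convex
hull contains no other point of `S` in its interior. -/
def IsHole (k : ℕ) (S H : Set Pt) : Prop :=
  H ⊆ S ∧ H.ncard = k ∧ ConvexPos H ∧
    ∀ p ∈ S, p ∈ interior (convexHull ℝ H) → p ∈ H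

/-- `S` contains a `k`-hole. -/
def HasHole (k : ℕ) (S : Set Pt) : Prop := ∃ H : Set Pt, IsHole k S H

/-- The points of `S` that are vertices of the convex hull of `S`. -/
def hullVertices (S : Set Pt) : Set Pt := {p ∈ S | p ∉ convexHull ℝ (S \ {p})}

/-- The points of `S` lying in the interior of the convex hull of `S`. -/
def interiorPts (S : Set Pt) : Set Pt := {p ∈ S | p ∈ interior (convexHull ℝ S)}

/-- `S` is `λ`-convex: every triangle with vertices in `S` contains at most `λ`
points of `S` in its interior. -/
def LambdaConvex (lam : ℕ) (S : Set Pt) : Prop :=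
  ∀ p ∈ S, ∀ q ∈ S, ∀ r ∈ S,
    (S ∩ interior (convexHull ℝ ({p, q, r} : Set Pt))).ncard ≤ lam

/-- Orientation determinant of three points. -/
def ori (p q r : Pt) : ℝ := (q.1 - p.1) * (r.2 - p.2) - (q.2 - p.2) * (r.1 - p.1)

/-- `p` is strictly inside the counterclockwise triangle `a b c`. -/
def Ins (a b c p : Pt) : Prop := 0 < ori a b p ∧ 0 < ori b c p ∧ 0 < ori c a p

/-- Covered region in the combinatorial model. -/
def Cov (u v w : Pt → ℝ) (X Y Z p : Pt) : Prop :=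
  (u p ≤ u X ∧ w X ≤ w p) ∨ (v p ≤ v Y ∧ u Y ≤ u p) ∨ (w p ≤ w Z ∧ v Z ≤ v p)

lemma three_pts (u v w : Pt → ℝ) (hs : ∀ p, u p + v p + w p = 0) (P Q R : Pt)
    (u1 : u P < u Q) (u2 : u Q < u R)
    (v1 : v P ≠ v Q) (v2 : v P ≠ v R) (v3 : v Q ≠ v R)
    (w1 : w P ≠ w Q) (w2 : w P ≠ w R) (w3 : w Q ≠ w R) :
    (v Q < v R ∧ w R < w P) ∨ (v R < v Q ∧ w Q < w P) ∨ (v R < v P ∧ w P < w Q) := by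
  have := hs P; have := hs Q; have := hs R
  by_contra hcon
  push Not at hcon
  obtain ⟨h1, h2, h3⟩ := hcon
  rcases lt_or_gt_of_ne v3 with h | h
  · have := h1 h
    have := h3 (by linarith)
    linarith
  · have := h2 h
    have := h3
    rcases lt_or_gt_of_ne v2 with h' | h'
    · linarith
    · have := h3 h'
      exact w1 (by linarith)

lemma exists_triple (u v w : Pt → ℝ) (hs : ∀ p, u p + v p + w p = 0) (I : Finset Pt)
    (hu : ∀ p ∈ I, ∀ q ∈ I, p ≠ q → u p ≠ u q)
    (hv : ∀ p ∈ I, ∀ q ∈ I, p ≠ q → v p ≠ v q)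
    (hw : ∀ p ∈ I, ∀ q ∈ I, p ≠ q → w p ≠ w q)
    (h3 : 3 ≤ I.card) :
    ∃ X ∈ I, ∃ Y ∈ I, ∃ Z ∈ I, u X < u Y ∧ v Y < v Z ∧ w Z < w X := by
  have main : ∀ P ∈ I, ∀ Q ∈ I, ∀ R ∈ I, u P < u Q → u Q < u R →
      ∃ X ∈ I, ∃ Y ∈ I, ∃ Z ∈ I, u X < u Y ∧ v Y < v Z ∧ w Z < w X := by
    intro P hP Q hQ R hR h1 h2
    have n1 : P ≠ Q := by rintro rfl; exact lt_irrefl _ h1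
    have n2 : Q ≠ R := by rintro rfl; exact lt_irrefl _ h2
    have n3 : P ≠ R := by rintro rfl; exact lt_asymm h1 h2
    rcases three_pts u v w hs P Q R h1 h2 (hv _ hP _ hQ n1) (hv _ hP _ hR n3) (hv _ hQ _ hR n2)
      (hw _ hP _ hQ n1) (hw _ hP _ hR n3) (hw _ hQ _ hR n2) with h | h | h
    · exact ⟨P, hP, Q, hQ, R, hR, h1, h.1, h.2⟩
    · exact ⟨P, hP, R, hR, Q, hQ, h1.trans h2, h.1, h.2⟩
    · exact ⟨Q, hQ, R, hR, P, hP, h2, h.1, h.2⟩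
  obtain ⟨P, Q, R, hP, hQ, hR, n1, n2, n3⟩ := Finset.two_lt_card_iff.1 (show 2 < I.card by omega)
  rcases lt_or_gt_of_ne (hu _ hP _ hQ n1) with a | a <;>
  rcases lt_or_gt_of_ne (hu _ hP _ hR n2) with b | b <;>
  rcases lt_or_gt_of_ne (hu _ hQ _ hR n3) with c | c
  · exact main P hP Q hQ R hR a c
  · exact main P hP R hR Q hQ b c
  · linarith
  · exact main R hR P hP Q hQ b a
  · exact main Q hQ P hP R hR a b
  · linarith
  · exact main Q hQ R hR P hP c b
  · exact main R hR Q hQ P hP c a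

set_option maxHeartbeats 1600000 in
lemma improve (u v w : Pt → ℝ) (hs : ∀ p, u p + v p + w p = 0) (I : Finset Pt)
    (hab : ∀ q ∈ I, ∀ P ∈ I, ∀ Q ∈ I, ∀ R ∈ I, P ≠ Q → P ≠ R → Q ≠ R →
      (u P < u q ∧ w q < w P) → (u Q < u q ∧ w q < w Q) → (u R < u q ∧ w q < w R) → False)
    (hbc : ∀ q ∈ I, ∀ P ∈ I, ∀ Q ∈ I, ∀ R ∈ I, P ≠ Q → P ≠ R → Q ≠ R →
      (v P < v q ∧ u q < u P) → (v Q < v q ∧ u q < u Q) → (v R < v q ∧ u q < u R) → False)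
    (hca : ∀ q ∈ I, ∀ P ∈ I, ∀ Q ∈ I, ∀ R ∈ I, P ≠ Q → P ≠ R → Q ≠ R →
      (w P < w q ∧ v q < v P) → (w Q < w q ∧ v q < v Q) → (w R < w q ∧ v q < v R) → False)
    (hu : ∀ p ∈ I, ∀ q ∈ I, p ≠ q → u p ≠ u q)
    (hv : ∀ p ∈ I, ∀ q ∈ I, p ≠ q → v p ≠ v q)
    (hw : ∀ p ∈ I, ∀ q ∈ I, p ≠ q → w p ≠ w q)
    (X Y Z p : Pt) (hX : X ∈ I) (hY : Y ∈ I) (hZ : Z ∈ I) (hp : p ∈ I)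
    (h1 : u X < u Y) (h2 : v Y < v Z) (h3 : w Z < w X) (hc : ¬ Cov u v w X Y Z p) :
    (u X < u p ∧ u p < u Y ∧ w Z < w p ∧ w p < w X) ∨
    (v Y < v p ∧ v p < v Z ∧ u X < u p ∧ u p < u Y) ∨
    (w Z < w p ∧ w p < w X ∧ v Y < v p ∧ v p < v Z) := by
  have sp := hs p; have sX := hs X; have sY := hs Y; have sZ := hs Z
  have nXY : X ≠ Y := by rintro rfl; exact lt_irrefl _ h1
  have nYZ : Y ≠ Z := by rintro rfl; exact lt_irrefl _ h2
  have nXZ : X ≠ Z := by rintro rfl; exact lt_irrefl _ h3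
  have npX : p ≠ X := by rintro rfl; exact hc (Or.inl ⟨le_rfl, le_rfl⟩)
  have npY : p ≠ Y := by rintro rfl; exact hc (Or.inr (Or.inl ⟨le_rfl, le_rfl⟩))
  have npZ : p ≠ Z := by rintro rfl; exact hc (Or.inr (Or.inr ⟨le_rfl, le_rfl⟩))
  simp only [Cov, not_or, not_and, not_le] at hc
  obtain ⟨c1, c2, c3⟩ := hc
  have k1 := hab Y hY X hX Z hZ p hp nXZ npX.symm npZ.symm
  have k2 := hbc Z hZ Y hY X hX p hp nXY.symm npY.symm npX.symm
  have k3 := hca X hX Z hZ Y hY p hp nYZ.symm npZ.symm npY.symm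
  have m1 := hab Z hZ X hX Y hY p hp nXY npX.symm npY.symm
  have m2 := hbc X hX Y hY Z hZ p hp nYZ npY.symm npZ.symm
  have m3 := hca Y hY Z hZ X hX p hp nXZ.symm npZ.symm npX.symm
  have q1 := hab p hp X hX Y hY Z hZ nXY nXZ nYZ
  have q2 := hbc p hp X hX Y hY Z hZ nXY nXZ nYZ
  have q3 := hca p hp X hX Y hY Z hZ nXY nXZ nYZ
  by_contra hcon
  simp only [not_or, not_and] at hcon
  obtain ⟨n1, n2, n3⟩ := hcon
  rcases lt_or_gt_of_ne (hu p hp X hX npX) with a | a <;>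
  rcases lt_or_gt_of_ne (hu p hp Y hY npY) with b | b <;>
  rcases lt_or_gt_of_ne (hv p hp Y hY npY) with c | c <;>
  rcases lt_or_gt_of_ne (hv p hp Z hZ npZ) with d | d <;>
  rcases lt_or_gt_of_ne (hw p hp X hX npX) with e | e <;>
  rcases lt_or_gt_of_ne (hw p hp Z hZ npZ) with f | f <;>
  first
  | linarith
  | (have := c1 a.le; linarith)
  | (have := c2 c.le; linarith)
  | (have := c3 f.le; linarith)
  | exact n1 a b f e
  | exact n2 c d a b
  | exact n3 f e c d
  | (refine k1 ⟨?_, ?_⟩ ⟨?_, ?_⟩ ⟨?_, ?_⟩ <;> linarith)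
  | (refine k2 ⟨?_, ?_⟩ ⟨?_, ?_⟩ ⟨?_, ?_⟩ <;> linarith)
  | (refine k3 ⟨?_, ?_⟩ ⟨?_, ?_⟩ ⟨?_, ?_⟩ <;> linarith)
  | (refine m1 ⟨?_, ?_⟩ ⟨?_, ?_⟩ ⟨?_, ?_⟩ <;> linarith)
  | (refine m2 ⟨?_, ?_⟩ ⟨?_, ?_⟩ ⟨?_, ?_⟩ <;> linarith)
  | (refine m3 ⟨?_, ?_⟩ ⟨?_, ?_⟩ ⟨?_, ?_⟩ <;> linarith)
  | (refine q1 ⟨?_, ?_⟩ ⟨?_, ?_⟩ ⟨?_, ?_⟩ <;> linarith)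
  | (refine q2 ⟨?_, ?_⟩ ⟨?_, ?_⟩ ⟨?_, ?_⟩ <;> linarith)
  | (refine q3 ⟨?_, ?_⟩ ⟨?_, ?_⟩ ⟨?_, ?_⟩ <;> linarith)

open Classical in
lemma comb (u v w : Pt → ℝ) (hs : ∀ p, u p + v p + w p = 0) (I : Finset Pt)
    (hab : ∀ q ∈ I, ∀ P ∈ I, ∀ Q ∈ I, ∀ R ∈ I, P ≠ Q → P ≠ R → Q ≠ R →
      (u P < u q ∧ w q < w P) → (u Q < u q ∧ w q < w Q) → (u R < u q ∧ w q < w R) → False)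
    (hbc : ∀ q ∈ I, ∀ P ∈ I, ∀ Q ∈ I, ∀ R ∈ I, P ≠ Q → P ≠ R → Q ≠ R →
      (v P < v q ∧ u q < u P) → (v Q < v q ∧ u q < u Q) → (v R < v q ∧ u q < u R) → False)
    (hca : ∀ q ∈ I, ∀ P ∈ I, ∀ Q ∈ I, ∀ R ∈ I, P ≠ Q → P ≠ R → Q ≠ R →
      (w P < w q ∧ v q < v P) → (w Q < w q ∧ v q < v Q) → (w R < w q ∧ v q < v R) → False)
    (hu : ∀ p ∈ I, ∀ q ∈ I, p ≠ q → u p ≠ u q)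
    (hv : ∀ p ∈ I, ∀ q ∈ I, p ≠ q → v p ≠ v q)
    (hw : ∀ p ∈ I, ∀ q ∈ I, p ≠ q → w p ≠ w q)
    (h3 : 3 ≤ I.card) :
    ∃ X ∈ I, ∃ Y ∈ I, ∃ Z ∈ I, u X < u Y ∧ v Y < v Z ∧ w Z < w X ∧
      ∀ p ∈ I, Cov u v w X Y Z p := by
  obtain ⟨X₀, hX₀, Y₀, hY₀, Z₀, hZ₀, h₀⟩ := exists_triple u v w hs I hu hv hw h3
  let T := (I ×ˢ (I ×ˢ I)).filter
    (fun t => u t.1 < u t.2.1 ∧ v t.2.1 < v t.2.2 ∧ w t.2.2 < w t.1)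
  have hT : T.Nonempty := ⟨(X₀, Y₀, Z₀), by simp [T, hX₀, hY₀, hZ₀, h₀]⟩
  obtain ⟨⟨X, Y, Z⟩, ht, hmax⟩ := Finset.exists_max_image T
    (fun t => (I.filter (fun p => Cov u v w t.1 t.2.1 t.2.2 p)).card) hT
  simp only [T, Finset.mem_filter, Finset.mem_product] at ht
  obtain ⟨⟨hX, hY, hZ⟩, h1, h2, h3⟩ := ht
  refine ⟨X, hX, Y, hY, Z, hZ, h1, h2, h3, ?_⟩
  intro p hp
  by_contra hc
  have key : ∀ X' Y' Z', X' ∈ I → Y' ∈ I → Z' ∈ I → u X' < u Y' → v Y' < v Z' → w Z' < w X' →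
      (∀ r, Cov u v w X Y Z r → Cov u v w X' Y' Z' r) → Cov u v w X' Y' Z' p → False := by
    intro X' Y' Z' hX' hY' hZ' a b c hsub hcp
    have hm := hmax (X', Y', Z') (by simp [T, hX', hY', hZ', a, b, c])
    refine absurd hm (not_le.2 (Finset.card_lt_card ?_))
    refine Finset.ssubset_iff_subset_ne.2 ⟨?_, ?_⟩
    · intro r hr
      simp only [Finset.mem_filter] at hr ⊢
      exact ⟨hr.1, hsub r hr.2⟩
    · intro heq
      have : p ∈ I.filter (fun p => Cov u v w X' Y' Z' p) := by simp [hp, hcp]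
      rw [← heq] at this
      exact hc (Finset.mem_filter.1 this).2
  rcases improve u v w hs I hab hbc hca hu hv hw X Y Z p hX hY hZ hp h1 h2 h3 hc with h | h | h
  · obtain ⟨a, b, c, d⟩ := h
    refine key p Y Z hp hY hZ b h2 c ?_ (Or.inl ⟨le_rfl, le_rfl⟩)
    rintro r (h | h | h)
    · exact Or.inl ⟨by linarith, by linarith⟩
    · exact Or.inr (Or.inl h)
    · exact Or.inr (Or.inr h)
  · obtain ⟨a, b, c, d⟩ := h
    refine key X p Z hX hp hZ c b h3 ?_ (Or.inr (Or.inl ⟨le_rfl, le_rfl⟩))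
    rintro r (h | h | h)
    · exact Or.inl h
    · exact Or.inr (Or.inl ⟨by linarith, by linarith⟩)
    · exact Or.inr (Or.inr h)
  · obtain ⟨a, b, c, d⟩ := h
    refine key X Y p hX hY hp h1 c b ?_ (Or.inr (Or.inr ⟨le_rfl, le_rfl⟩))
    rintro r (h | h | h)
    · exact Or.inl h
    · exact Or.inr (Or.inl h)
    · exact Or.inr (Or.inr ⟨by linarith, by linarith⟩)

lemma ori_cyc (p q r : Pt) : ori p q r = ori q r p := by unfold ori; ring

lemma ori_swap (p q r : Pt) : ori p q r = - ori p r q := by unfold ori; ring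

lemma ori_self (p q : Pt) : ori p q q = 0 := by unfold ori; ring

lemma ori_self' (p q : Pt) : ori p q p = 0 := by unfold ori; ring

lemma ori_comb (A B p q : Pt) (s t : ℝ) (h : s + t = 1) :
    ori A B (s • p + t • q) = s * ori A B p + t * ori A B q := by
  obtain rfl : s = 1 - t := by linarith
  simp only [ori, Prod.fst_add, Prod.snd_add, Prod.smul_fst, Prod.smul_snd, smul_eq_mul]
  ring

lemma seg_sep (A B p q r s : Pt) (hp : 0 < ori A B p) (hq : 0 ≤ ori A B q)
    (hr : ori A B r ≤ 0) (hs : ori A B s < 0) (hne : q ≠ r) :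
    segment ℝ p q ∩ segment ℝ r s = ∅ := by
  rw [Set.eq_empty_iff_forall_notMem]
  rintro z ⟨⟨x, y, hx, hy, hxy, rfl⟩, ⟨x', y', hx', hy', hxy', hz⟩⟩
  have e := congrArg (ori A B) hz
  rw [ori_comb _ _ _ _ _ _ hxy, ori_comb _ _ _ _ _ _ hxy'] at e
  have k1 := mul_nonneg hx hp.le
  have k2 := mul_nonneg hy hq
  have k3 := mul_nonneg hx' (neg_nonneg.2 hr)
  have k4 := mul_nonneg hy' (neg_nonneg.2 hs.le)
  have x0 : x = 0 := by
    have : x * ori A B p = 0 := by linarith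
    rcases mul_eq_zero.1 this with h | h
    · exact h
    · linarith
  have y0 : y' = 0 := by
    have : y' * ori A B s = 0 := by linarith
    rcases mul_eq_zero.1 this with h | h
    · exact h
    · linarith
  subst x0 y0
  obtain rfl : y = 1 := by linarith
  obtain rfl : x' = 1 := by linarith
  apply hne
  simpa using hz.symm

lemma seg_adj (p q r : Pt) (h : ori p q r ≠ 0) :
    segment ℝ p q ∩ segment ℝ q r = {q} := by
  apply Set.Subset.antisymm
  · rintro z ⟨⟨x, y, hx, hy, hxy, rfl⟩, ⟨x', y', hx', hy', hxy', hz⟩⟩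
    have e := congrArg (ori p q) hz
    rw [ori_comb _ _ _ _ _ _ hxy, ori_comb _ _ _ _ _ _ hxy', ori_self, ori_self'] at e
    have y0 : y' = 0 := by
      have : y' * ori p q r = 0 := by linarith
      rcases mul_eq_zero.1 this with h' | h'
      · exact h'
      · exact absurd h' h
    subst y0
    obtain rfl : x' = 1 := by linarith
    rw [← hz]
    simp
  · rintro z rfl
    exact ⟨right_mem_segment _ _ _, left_mem_segment _ _ _⟩

/-- The hexagon. -/
def hex (a b c X Y Z : Pt) : ZMod 6 → Pt := (![a, X, b, Y, c, Z] : Fin 6 → Pt)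

lemma not_int (v : ZMod 6 → Pt) (A B A' B' s d : Pt) (h1 : ori A B s < 0) (h2 : ori A' B' s < 0)
    (d1 : cross2 (B - A) d ≤ 0) (d2 : cross2 (B' - A') d ≤ 0) (hd : d ≠ 0)
    (hv : ∀ i, (0 ≤ ori A B (v i) ∧ 0 ≤ ori A B (v (i+1))) ∨
      (0 ≤ ori A' B' (v i) ∧ 0 ≤ ori A' B' (v (i+1)))) : s ∉ polyInterior 6 v := by
  rintro ⟨-, hb⟩
  let C : Set Pt := {x | ori A B x < 0 ∧ ori A' B' x < 0}
  have hconv : Convex ℝ C := by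
    intro x hx y hy α β hα hβ hab
    have key : ∀ P Q : ℝ, P < 0 → Q < 0 → α * P + β * Q < 0 := by
      intro P Q hP hQ
      rcases hα.eq_or_lt with h | h
      · subst h
        obtain rfl : β = 1 := by linarith
        linarith
      · have := mul_neg_of_pos_of_neg h hP
        have := mul_nonneg hβ (neg_nonneg.2 hQ.le)
        linarith
    constructor
    · rw [ori_comb _ _ _ _ _ _ hab]; exact key _ _ hx.1 hy.1
    · rw [ori_comb _ _ _ _ _ _ hab]; exact key _ _ hx.2 hy.2
  have hdis : C ⊆ (polyBoundary 6 v)ᶜ := by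
    intro x hx hxb
    simp only [polyBoundary, Set.mem_iUnion] at hxb
    obtain ⟨i, α, β, hα, hβ, hab, rfl⟩ := hxb
    obtain ⟨hx1, hx2⟩ := hx
    rw [ori_comb _ _ _ _ _ _ hab] at hx1 hx2
    rcases hv i with h | h
    · have := mul_nonneg hα h.1; have := mul_nonneg hβ h.2; linarith
    · have := mul_nonneg hα h.1; have := mul_nonneg hβ h.2; linarith
  have hsub : C ⊆ connectedComponentIn (polyBoundary 6 v)ᶜ s :=
    hconv.isPreconnected.subset_connectedComponentIn ⟨h1, h2⟩ hdis
  obtain ⟨R, hR⟩ := isBounded_iff_forall_norm_le.1 (hb.subset hsub)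
  have hR0 : 0 ≤ R := (norm_nonneg s).trans (hR s ⟨h1, h2⟩)
  have hdn : 0 < ‖d‖ := norm_pos_iff.2 hd
  set t := (R + ‖s‖ + 1) / ‖d‖ with ht
  have ht0 : 0 ≤ t := by positivity
  have hmem : s + t • d ∈ C := by
    have e : ∀ A B : Pt, ori A B (s + t • d) = ori A B s + t * cross2 (B - A) d := by
      intro A B
      simp only [ori, cross2, Prod.fst_add, Prod.snd_add, Prod.smul_fst, Prod.smul_snd, smul_eq_mul,
        Prod.fst_sub, Prod.snd_sub]
      ring
    constructor
    · rw [e]; have := mul_nonneg ht0 (neg_nonneg.2 d1); linarith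
    · rw [e]; have := mul_nonneg ht0 (neg_nonneg.2 d2); linarith
  have h5 := hR _ hmem
  have h6 : ‖t • d‖ = R + ‖s‖ + 1 := by
    rw [norm_smul, Real.norm_of_nonneg ht0, ht]; field_simp
  have h7 : ‖t • d‖ ≤ ‖s + t • d‖ + ‖s‖ := by
    have := norm_sub_le (s + t • d) s
    simpa using this
  linarith

lemma area_pos (x y z aX bX bY cY cZ aZ D : ℝ) (hx : 0 < x) (hy : 0 < y) (hz : 0 < z)
    (e1 : aX + bX + x = D) (e2 : y + bY + cY = D) (e3 : aZ + z + cZ = D)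
    (paX : 0 < aX) (pbX : 0 < bX) (pbY : 0 < bY) (pcY : 0 < cY) (pcZ : 0 < cZ) (paZ : 0 < aZ)
    (h1 : x * y < cY * aX) (h2 : y * z < aZ * bY) (h3 : z * x < bX * cZ) : x + y + z < D := by
  by_contra hcon
  push Not at hcon
  have f1 : ¬ (aX ≤ y ∧ cY ≤ x) := by
    rintro ⟨h, h'⟩; have := mul_le_mul h' h paX.le hx.le; linarith
  have f2 : ¬ (bY ≤ z ∧ aZ ≤ y) := by
    rintro ⟨h, h'⟩; have := mul_le_mul h' h pbY.le hy.le; linarith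
  have f3 : ¬ (cZ ≤ x ∧ bX ≤ z) := by
    rintro ⟨h, h'⟩; have := mul_le_mul h' h pcZ.le hz.le; linarith
  by_cases h : aX ≤ y
  · have g1 : x < cY := by by_contra hh; exact f1 ⟨h, not_lt.1 hh⟩
    have g2 : bY ≤ z := by linarith
    have g3 : y < aZ := by by_contra hh; exact f2 ⟨g2, not_lt.1 hh⟩
    have g4 : cZ ≤ x := by linarith
    have g5 : z < bX := by by_contra hh; exact f3 ⟨g4, not_lt.1 hh⟩
    have m1 : 0 ≤ (y - aX) * (cY - x) := mul_nonneg (by linarith) (by linarith)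
    have m2 : 0 ≤ (z - bY) * (aZ - y) := mul_nonneg (by linarith) (by linarith)
    have m3 : 0 ≤ (x - cZ) * (bX - z) := mul_nonneg (by linarith) (by linarith)
    have b1 : 0 ≤ x * (y + z - aX - bX) := mul_nonneg hx.le (by linarith)
    have b2 : 0 ≤ y * (x + z - bY - cY) := mul_nonneg hy.le (by linarith)
    have b3 : 0 ≤ z * (x + y - cZ - aZ) := mul_nonneg hz.le (by linarith)
    nlinarith
  · push Not at h
    have g5 : bX ≤ z := by linarith
    have g4 : x < cZ := by by_contra hh; exact f3 ⟨not_lt.1 hh, g5⟩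
    have g3 : aZ ≤ y := by linarith
    have g2 : z < bY := by by_contra hh; exact f2 ⟨not_lt.1 hh, g3⟩
    have g1 : cY ≤ x := by linarith
    have m1 : 0 ≤ (aX - y) * (x - cY) := mul_nonneg (by linarith) (by linarith)
    have m2 : 0 ≤ (bY - z) * (y - aZ) := mul_nonneg (by linarith) (by linarith)
    have m3 : 0 ≤ (cZ - x) * (z - bX) := mul_nonneg (by linarith) (by linarith)
    have b1 : 0 ≤ x * (y + z - aX - bX) := mul_nonneg hx.le (by linarith)
    have b2 : 0 ≤ y * (x + z - bY - cY) := mul_nonneg hy.le (by linarith)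
    have b3 : 0 ≤ z * (x + y - cZ - aZ) := mul_nonneg hz.le (by linarith)
    nlinarith

lemma ori_b (a b c P Q : Pt) :
    ori b P Q * ori a b c = ori a b P * ori b c Q - ori a b Q * ori b c P := by
  unfold ori; ring

lemma ori_sum (a b c P : Pt) : ori a b P + ori b c P + ori c a P = ori a b c := by
  unfold ori; ring

lemma hex_area (a b c X Y Z : Pt) :
    signedArea 6 (hex a b c X Y Z) = ori a b c - ori a b X - ori b c Y - ori c a Z := by
  have : signedArea 6 (hex a b c X Y Z) =
      cross2 a X + cross2 X b + cross2 b Y + cross2 Y c + cross2 c Z + cross2 Z a := by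
    unfold signedArea
    rw [dif_neg (by norm_num)]
    exact Fin.sum_univ_six _
  rw [this]
  simp only [cross2, ori]
  ring

lemma vc (p q r : Pt) : cross2 (q - p) (r - q) = ori p q r := by
  simp only [cross2, ori, Prod.fst_sub, Prod.snd_sub]; ring

lemma hex_std (a b c X Y Z : Pt) (hD : 0 < ori a b c) (hX : Ins a b c X) (hY : Ins a b c Y)
    (hZ : Ins a b c Z) (h1 : ori b X Y < 0) (h2 : ori c Y Z < 0) (h3 : ori a Z X < 0) :
    IsStandardPseudoTriangle 6 (hex a b c X Y Z) := by
  obtain ⟨X1, X2, X3⟩ := hX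
  obtain ⟨Y1, Y2, Y3⟩ := hY
  obtain ⟨Z1, Z2, Z3⟩ := hZ
  have ne : ∀ {p q r : Pt}, ori p q r ≠ 0 → p ≠ q := by
    rintro p q r h rfl; apply h; unfold ori; ring
  have ne' : ∀ {p q r : Pt}, ori p q r ≠ 0 → q ≠ r := by
    rintro p q r h rfl; apply h; unfold ori; ring
  have nab := ne hD.ne'
  have nbc := ne' hD.ne'
  have nca : c ≠ a := ne (r := b) (by rw [ori_cyc]; exact hD.ne')
  have naX : a ≠ X := (ne' X3.ne')
  have naY : a ≠ Y := (ne' Y3.ne')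
  have naZ : a ≠ Z := (ne' Z3.ne')
  have nbX : b ≠ X := (ne' X1.ne')
  have nbY : b ≠ Y := (ne' Y1.ne')
  have nbZ : b ≠ Z := (ne' Z1.ne')
  have ncX : c ≠ X := (ne' X2.ne')
  have ncY : c ≠ Y := (ne' Y2.ne')
  have ncZ : c ≠ Z := (ne' Z2.ne')
  have nXY := ne' h1.ne
  have nYZ := ne' h2.ne
  have nZX := ne' h3.ne
  have hA : 0 < signedArea 6 (hex a b c X Y Z) := by
    rw [hex_area]
    have := area_pos (ori a b X) (ori b c Y) (ori c a Z) (ori b c X) (ori c a X) (ori c a Y)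
      (ori a b Y) (ori a b Z) (ori b c Z) (ori a b c) X1 Y2 Z3
      (by rw [← ori_sum a b c X]; ring) (by rw [← ori_sum a b c Y]; ring)
      (by rw [← ori_sum a b c Z]; ring) X2 X3 Y3 Y1 Z1 Z2 ?_ ?_ ?_
    · linarith
    · have e := ori_b a b c X Y
      have := mul_neg_of_neg_of_pos h1 hD
      linarith
    · have e := ori_b b c a Y Z
      rw [← ori_cyc a b c] at e
      have := mul_neg_of_neg_of_pos h2 hD
      linarith
    · have e := ori_b c a b Z X
      rw [ori_cyc c a b] at e
      have := mul_neg_of_neg_of_pos h3 hD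
      linarith
  -- turning numbers
  have t0 : vtxCross 6 (hex a b c X Y Z) 0 = - ori a Z X :=
    (vc Z a X).trans (by unfold ori; ring)
  have t1 : vtxCross 6 (hex a b c X Y Z) 1 = - ori a b X :=
    (vc a X b).trans (by unfold ori; ring)
  have t2 : vtxCross 6 (hex a b c X Y Z) 2 = - ori b X Y :=
    (vc X b Y).trans (by unfold ori; ring)
  have t3 : vtxCross 6 (hex a b c X Y Z) 3 = - ori b c Y :=
    (vc b Y c).trans (by unfold ori; ring)
  have t4 : vtxCross 6 (hex a b c X Y Z) 4 = - ori c Y Z :=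
    (vc Y c Z).trans (by unfold ori; ring)
  have t5 : vtxCross 6 (hex a b c X Y Z) 5 = - ori c a Z :=
    (vc c Z a).trans (by unfold ori; ring)
  have cpos : ∀ i, IsConvexVtx 6 (hex a b c X Y Z) i ↔ 0 < vtxCross 6 (hex a b c X Y Z) i := by
    intro i
    exact mul_pos_iff_of_pos_right hA
  have c0 : IsConvexVtx 6 (hex a b c X Y Z) 0 := by rw [cpos, t0]; linarith
  have c2 : IsConvexVtx 6 (hex a b c X Y Z) 2 := by rw [cpos, t2]; linarith
  have c4 : IsConvexVtx 6 (hex a b c X Y Z) 4 := by rw [cpos, t4]; linarith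
  have c1 : ¬ IsConvexVtx 6 (hex a b c X Y Z) 1 := by rw [cpos, t1]; linarith
  have c3 : ¬ IsConvexVtx 6 (hex a b c X Y Z) 3 := by rw [cpos, t3]; linarith
  have c5 : ¬ IsConvexVtx 6 (hex a b c X Y Z) 5 := by rw [cpos, t5]; linarith
  have all6 : ∀ (P : ZMod 6 → Prop), P 0 → P 1 → P 2 → P 3 → P 4 → P 5 → ∀ i, P i := by
    intro P p0 p1 p2 p3 p4 p5 i
    have : i = 0 ∨ i = 1 ∨ i = 2 ∨ i = 3 ∨ i = 4 ∨ i = 5 := by revert i; decide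
    rcases this with rfl | rfl | rfl | rfl | rfl | rfl <;> assumption
  have sep := seg_sep
  have sw : ∀ p q : Pt, segment ℝ p q = segment ℝ q p := segment_symm ℝ
  have P1 : ori b X a = ori a b X := by unfold ori; ring
  have P2 : ori b X c = - ori b c X := by unfold ori; ring
  have P3 : ori a X b = - ori a b X := by unfold ori; ring
  have P4 : ori a X c = ori c a X := by unfold ori; ring
  have P5 : ori a X Z = - ori a Z X := by unfold ori; ring
  have Q1 : ori c Y b = ori b c Y := by unfold ori; ring
  have Q2 : ori c Y a = - ori c a Y := by unfold ori; ring
  have Q3 : ori b Y c = - ori b c Y := by unfold ori; ring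
  have Q5 : ori b Y X = - ori b X Y := by unfold ori; ring
  have R1 : ori a Z c = ori c a Z := by unfold ori; ring
  have R2 : ori a Z b = - ori a b Z := by unfold ori; ring
  have R3 : ori c Z a = - ori c a Z := by unfold ori; ring
  have R5 : ori c Z Y = - ori c Y Z := by unfold ori; ring
  have e02 : segment ℝ a X ∩ segment ℝ b Y = ∅ :=
    sep b X a X b Y (by linarith) (ori_self _ _).ge (ori_self' _ _).le h1 nbX.symm
  have e03 : segment ℝ a X ∩ segment ℝ Y c = ∅ :=
    sep b X a X Y c (by linarith) (ori_self _ _).ge h1.le (by linarith) nXY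
  have e04 : segment ℝ a X ∩ segment ℝ c Z = ∅ := by
    rw [Set.inter_comm]
    exact sep a Z c Z a X (by linarith) (ori_self _ _).ge (ori_self' _ _).le h3 naZ.symm
  have e13 : segment ℝ X b ∩ segment ℝ Y c = ∅ :=
    sep b Y X b Y c (by linarith) (ori_self' _ _).ge (ori_self _ _).le (by linarith) nbY
  have e14 : segment ℝ X b ∩ segment ℝ c Z = ∅ := by
    rw [Set.inter_comm]
    exact sep a Z c Z X b (by linarith) (ori_self _ _).ge h3.le (by linarith) nZX
  have e15 : segment ℝ X b ∩ segment ℝ Z a = ∅ := by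
    rw [Set.inter_comm]
    exact sep a X Z a X b (by linarith) (ori_self' _ _).ge (ori_self _ _).le (by linarith) naX
  have e24 : segment ℝ b Y ∩ segment ℝ c Z = ∅ :=
    sep c Y b Y c Z (by linarith) (ori_self _ _).ge (ori_self' _ _).le h2 ncY.symm
  have e25 : segment ℝ b Y ∩ segment ℝ Z a = ∅ :=
    sep c Y b Y Z a (by linarith) (ori_self _ _).ge h2.le (by linarith) nYZ
  have e35 : segment ℝ Y c ∩ segment ℝ Z a = ∅ :=
    sep c Z Y c Z a (by linarith) (ori_self' _ _).ge (ori_self _ _).le (by linarith) ncZ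
  refine ⟨⟨⟨by norm_num, ?_, ?_, ?_⟩, ?_, ?_⟩, ?_⟩
  · intro i j hij
    have hij' : (![a, X, b, Y, c, Z] : Fin 6 → Pt) i = (![a, X, b, Y, c, Z] : Fin 6 → Pt) j := hij
    revert i j
    change ∀ i j : Fin 6, _
    intro i j _ hij
    fin_cases i <;> fin_cases j <;>
    first
    | rfl
    | (exfalso; simp at hij; grind)
  · intro i j
    revert i j
    apply all6 <;> apply all6 <;> intro g1 g2 g3 <;>
    first
    | exact absurd rfl g1
    | exact absurd rfl g2
    | exact absurd rfl g3
    | exact e02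
    | exact e03
    | exact e04
    | exact e13
    | exact e14
    | exact e15
    | exact e24
    | exact e25
    | exact e35
    | (rw [Set.inter_comm]; first
        | exact e02
        | exact e03
        | exact e04
        | exact e13
        | exact e14
        | exact e15
        | exact e24
        | exact e25
        | exact e35)
  · apply all6
    · exact seg_adj a X b (by rw [P3]; linarith)
    · exact seg_adj X b Y (by rw [ori_cyc, ori_swap]; linarith)
    · exact seg_adj b Y c (by rw [Q3]; linarith)
    · exact seg_adj Y c Z (by rw [ori_cyc, ori_swap]; linarith)
    · exact seg_adj c Z a (by rw [R3]; linarith)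
    · exact seg_adj Z a X (by rw [ori_cyc, ori_swap]; linarith)
  · apply all6
    · rw [t0]; linarith
    · rw [t1]; linarith
    · rw [t2]; linarith
    · rw [t3]; linarith
    · rw [t4]; linarith
    · rw [t5]; linarith
  · have : {i : ZMod 6 | IsConvexVtx 6 (hex a b c X Y Z) i} = (({0, 2, 4} : Finset (ZMod 6)) : Set (ZMod 6)) := by
      ext i
      revert i
      apply all6
      · exact ⟨fun _ => by decide, fun _ => c0⟩
      · exact ⟨fun h => absurd h c1, fun h => absurd h (by decide)⟩
      · exact ⟨fun _ => by decide, fun _ => c2⟩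
      · exact ⟨fun h => absurd h c3, fun h => absurd h (by decide)⟩
      · exact ⟨fun _ => by decide, fun _ => c4⟩
      · exact ⟨fun h => absurd h c5, fun h => absurd h (by decide)⟩
    rw [this, Set.ncard_coe_finset]
    rfl
  · apply all6
    · exact fun _ => c1
    · exact fun h => absurd h c1
    · exact fun _ => c3
    · exact fun h => absurd h c3
    · exact fun _ => c5
    · exact fun h => absurd h c5

lemma collinear_of_ori (p q r : Pt) (hpq : p ≠ q) (h : ori p q r = 0) :
    Collinear ℝ ({p, q, r} : Set Pt) := by
  rw [collinear_iff_of_mem (p₀ := p) (by simp)]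
  refine ⟨q - p, ?_⟩
  have key : ∃ t : ℝ, r = t • (q - p) +ᵥ p := by
    unfold ori at h
    by_cases h1 : q.1 - p.1 = 0
    · have h2 : q.2 - p.2 ≠ 0 := by
        intro h2
        exact hpq (Prod.ext (by linarith) (by linarith))
      refine ⟨(r.2 - p.2) / (q.2 - p.2), ?_⟩
      rw [h1] at h
      have : r.1 - p.1 = 0 := by
        have : (q.2 - p.2) * (r.1 - p.1) = 0 := by linarith
        exact (mul_eq_zero.1 this).resolve_left h2
      apply Prod.ext
      · simp [h1]; linarith
      · simp; field_simp; ring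
    · refine ⟨(r.1 - p.1) / (q.1 - p.1), ?_⟩
      apply Prod.ext
      · simp; field_simp; ring
      · simp; field_simp; linarith
  rintro x (rfl | rfl | rfl)
  · exact ⟨0, by simp⟩
  · exact ⟨1, by simp⟩
  · exact key

lemma br (o D x y x' y' : ℝ) (hD : 0 < D) (hx : 0 < x) (hy : 0 < y) (hx' : 0 < x') (hy' : 0 < y')
    (e : o * D = x * y' - x' * y) :
    Real.log x - Real.log y < Real.log x' - Real.log y' ↔ o < 0 := by
  rw [← Real.log_div hx.ne' hy.ne', ← Real.log_div hx'.ne' hy'.ne',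
    Real.log_lt_log_iff (by positivity) (by positivity), div_lt_div_iff₀ hy hy']
  constructor
  · intro h
    by_contra ho
    have := mul_nonneg (not_lt.1 ho) hD.le
    linarith
  · intro h
    have := mul_neg_of_neg_of_pos h hD
    linarith

/-- Number of points of `S` strictly inside the triangle `a b c`. -/
def cnt (S : Set Pt) (a b c : Pt) : ℕ := {p ∈ S | Ins a b c p}.ncard

lemma Ins_cyc (a b c p : Pt) : Ins b c a p ↔ Ins a b c p := by
  unfold Ins; tauto

lemma cnt_cyc (S : Set Pt) (a b c : Pt) : cnt S b c a = cnt S a b c := by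
  unfold cnt; simp only [Ins_cyc]

lemma no_triple (S : Set Pt) (hfin : S.Finite) (a b c : Pt) (ha : a ∈ S) (hb : b ∈ S)
    (hD : 0 < ori a b c)
    (hmin : ∀ a' ∈ S, ∀ b' ∈ S, ∀ c' ∈ S, 0 < ori a' b' c' → 3 ≤ cnt S a' b' c' →
      cnt S a b c ≤ cnt S a' b' c')
    (q : Pt) (hq : q ∈ S) (hqi : Ins a b c q) (P Q R : Pt) (hP : P ∈ S) (hQ : Q ∈ S) (hR : R ∈ S)
    (n1 : P ≠ Q) (n2 : P ≠ R) (n3 : Q ≠ R) (iP : Ins a b q P) (iQ : Ins a b q Q)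
    (iR : Ins a b q R) : False := by
  have f1 : {p ∈ S | Ins a b q p}.Finite := hfin.subset (Set.sep_subset _ _)
  have f2 : {p ∈ S | Ins a b c p}.Finite := hfin.subset (Set.sep_subset _ _)
  have h3 : 3 ≤ cnt S a b q := by
    have : ({P, Q, R} : Set Pt).ncard = 3 := Set.ncard_eq_three.2 ⟨P, Q, R, n1, n2, n3, rfl⟩
    rw [← this]
    apply Set.ncard_le_ncard _ f1
    rintro x (rfl | rfl | rfl)
    · exact ⟨hP, iP⟩
    · exact ⟨hQ, iQ⟩
    · exact ⟨hR, iR⟩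
  have h4 := hmin a ha b hb q hq hqi.1 h3
  have h5 : cnt S a b q < cnt S a b c := by
    apply Set.ncard_lt_ncard _ f2
    refine Set.ssubset_iff_subset_ne.2 ⟨?_, ?_⟩
    · rintro p ⟨hp, i1, i2, i3⟩
      obtain ⟨j1, j2, j3⟩ := hqi
      refine ⟨hp, i1, ?_, ?_⟩
      · have e : ori a b q * ori b c p = ori b q p * ori a b c + ori a b p * ori b c q := by
          unfold ori; ring
        have : 0 < ori a b q * ori b c p := by rw [e]; positivity
        exact (mul_pos_iff_of_pos_left j1).1 this
      · have e : ori a b q * ori c a p = ori q a p * ori a b c + ori a b p * ori c a q := by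
          unfold ori; ring
        have : 0 < ori a b q * ori c a p := by rw [e]; positivity
        exact (mul_pos_iff_of_pos_left j1).1 this
    · intro h
      have : q ∈ {p ∈ S | Ins a b q p} := by rw [h]; exact ⟨hq, hqi⟩
      have := this.2.2.1
      rw [ori_self] at this
      exact lt_irrefl _ this
  omega

lemma hex_edges (a b c X Y Z : Pt) (P : Pt → Pt → Prop) (h0 : P a X) (h1 : P X b) (h2 : P b Y)
    (h3 : P Y c) (h4 : P c Z) (h5 : P Z a) (i : ZMod 6) :
    P (hex a b c X Y Z i) (hex a b c X Y Z (i + 1)) := by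
  have : i = 0 ∨ i = 1 ∨ i = 2 ∨ i = 3 ∨ i = 4 ∨ i = 5 := by revert i; decide
  rcases this with rfl | rfl | rfl | rfl | rfl | rfl <;> assumption

lemma hex_empty (a b c X Y Z s : Pt) (hD : 0 < ori a b c) (hX : Ins a b c X) (hY : Ins a b c Y)
    (hZ : Ins a b c Z) (h1 : ori b X Y < 0) (h2 : ori c Y Z < 0) (h3 : ori a Z X < 0)
    (hs : (ori b s X < 0 ∧ ori a X s < 0) ∨ (ori c s Y < 0 ∧ ori b Y s < 0) ∨
      (ori a s Z < 0 ∧ ori c Z s < 0) ∨ ori a b s < 0 ∨ ori b c s < 0 ∨ ori c a s < 0) :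
    s ∉ polyInterior 6 (hex a b c X Y Z) := by
  obtain ⟨X1, X2, X3⟩ := hX
  obtain ⟨Y1, Y2, Y3⟩ := hY
  obtain ⟨Z1, Z2, Z3⟩ := hZ
  have hD2 : ori b c a = ori a b c := (ori_cyc a b c).symm
  have hD3 : ori c a b = ori a b c := (ori_cyc c a b)
  have s1 := ori_self
  have s2 := ori_self'
  have dsub : ∀ A B C : Pt, cross2 (B - A) (C - A) = ori A B C := by
    intro A B C; simp only [cross2, ori, Prod.fst_sub, Prod.snd_sub]
  have dsub' : ∀ A B C : Pt, cross2 (B - A) (C - B) = ori A B C := vc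
  have dself : ∀ A B : Pt, cross2 (B - A) (B - A) = 0 := by
    intro A B; simp only [cross2]; ring
  rcases hs with ⟨g1, g2⟩ | ⟨g1, g2⟩ | ⟨g1, g2⟩ | g | g | g
  · have g1' : ori X b s < 0 := by rw [ori_cyc]; exact g1
    refine not_int _ X b a X s (s - X) g1' g2 (by rw [dsub]; exact g1'.le)
      (by rw [dsub']; exact g2.le) ?_ ?_
    · intro h; rw [sub_eq_zero] at h; rw [h, s1] at g2; exact lt_irrefl _ g2
    · have q1 : 0 ≤ ori X b Y := by rw [ori_cyc, ori_swap]; linarith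
      have q2 : 0 ≤ ori X b c := by rw [ori_cyc]; exact X2.le
      have q3 : 0 ≤ ori a X c := by rw [← ori_cyc]; exact X3.le
      have q4 : 0 ≤ ori a X Z := by rw [ori_swap]; linarith
      exact hex_edges a b c X Y Z (fun x y => (0 ≤ ori X b x ∧ 0 ≤ ori X b y) ∨
        (0 ≤ ori a X x ∧ 0 ≤ ori a X y))
        (Or.inr ⟨(s2 _ _).ge, (s1 _ _).ge⟩) (Or.inl ⟨(s2 _ _).ge, (s1 _ _).ge⟩)
        (Or.inl ⟨(s1 _ _).ge, q1⟩) (Or.inl ⟨q1, q2⟩) (Or.inr ⟨q3, q4⟩)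
        (Or.inr ⟨q4, (s2 _ _).ge⟩)
  · have g1' : ori Y c s < 0 := by rw [ori_cyc]; exact g1
    refine not_int _ Y c b Y s (s - Y) g1' g2 (by rw [dsub]; exact g1'.le)
      (by rw [dsub']; exact g2.le) ?_ ?_
    · intro h; rw [sub_eq_zero] at h; rw [h, s1] at g2; exact lt_irrefl _ g2
    · have q1 : 0 ≤ ori Y c Z := by rw [ori_cyc, ori_swap]; linarith
      have q2 : 0 ≤ ori Y c a := by rw [ori_cyc]; exact Y3.le
      have q3 : 0 ≤ ori b Y a := by rw [← ori_cyc]; exact Y1.le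
      have q4 : 0 ≤ ori b Y X := by rw [ori_swap]; linarith
      exact hex_edges a b c X Y Z (fun x y => (0 ≤ ori Y c x ∧ 0 ≤ ori Y c y) ∨
        (0 ≤ ori b Y x ∧ 0 ≤ ori b Y y))
        (Or.inr ⟨q3, q4⟩) (Or.inr ⟨q4, (s2 _ _).ge⟩)
        (Or.inr ⟨(s2 _ _).ge, (s1 _ _).ge⟩) (Or.inl ⟨(s2 _ _).ge, (s1 _ _).ge⟩)
        (Or.inl ⟨(s1 _ _).ge, q1⟩) (Or.inl ⟨q1, q2⟩)
  · have g1' : ori Z a s < 0 := by rw [ori_cyc]; exact g1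
    refine not_int _ Z a c Z s (s - Z) g1' g2 (by rw [dsub]; exact g1'.le)
      (by rw [dsub']; exact g2.le) ?_ ?_
    · intro h; rw [sub_eq_zero] at h; rw [h, s1] at g2; exact lt_irrefl _ g2
    · have q1 : 0 ≤ ori Z a X := by rw [ori_cyc, ori_swap]; linarith
      have q2 : 0 ≤ ori Z a b := by rw [ori_cyc]; exact Z1.le
      have q3 : 0 ≤ ori c Z b := by rw [← ori_cyc]; exact Z2.le
      have q4 : 0 ≤ ori c Z Y := by rw [ori_swap]; linarith
      exact hex_edges a b c X Y Z (fun x y => (0 ≤ ori Z a x ∧ 0 ≤ ori Z a y) ∨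
        (0 ≤ ori c Z x ∧ 0 ≤ ori c Z y))
        (Or.inl ⟨(s1 _ _).ge, q1⟩) (Or.inl ⟨q1, q2⟩)
        (Or.inr ⟨q3, q4⟩) (Or.inr ⟨q4, (s2 _ _).ge⟩)
        (Or.inr ⟨(s2 _ _).ge, (s1 _ _).ge⟩) (Or.inl ⟨(s2 _ _).ge, (s1 _ _).ge⟩)
  · refine not_int _ a b a b s (b - a) g g (dself _ _).le (dself _ _).le ?_ ?_
    · intro h; rw [sub_eq_zero] at h; rw [h] at hD; unfold ori at hD; linarith
    · have := (s1 a b).ge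
      have := (s2 a b).ge
      exact hex_edges a b c X Y Z (fun x y => (0 ≤ ori a b x ∧ 0 ≤ ori a b y) ∨
        (0 ≤ ori a b x ∧ 0 ≤ ori a b y)) (by left; constructor <;> linarith)
        (by left; constructor <;> linarith) (by left; constructor <;> linarith)
        (by left; constructor <;> linarith) (by left; constructor <;> linarith)
        (by left; constructor <;> linarith)
  · refine not_int _ b c b c s (c - b) g g (dself _ _).le (dself _ _).le ?_ ?_
    · intro h; rw [sub_eq_zero] at h; rw [h, s1] at hD; exact lt_irrefl _ hD
    · have := (s1 b c).ge
      have := (s2 b c).ge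
      exact hex_edges a b c X Y Z (fun x y => (0 ≤ ori b c x ∧ 0 ≤ ori b c y) ∨
        (0 ≤ ori b c x ∧ 0 ≤ ori b c y)) (by left; constructor <;> linarith)
        (by left; constructor <;> linarith) (by left; constructor <;> linarith)
        (by left; constructor <;> linarith) (by left; constructor <;> linarith)
        (by left; constructor <;> linarith)
  · refine not_int _ c a c a s (a - c) g g (dself _ _).le (dself _ _).le ?_ ?_
    · intro h; rw [sub_eq_zero] at h; rw [h, s2] at hD; exact lt_irrefl _ hD
    · have := (s1 c a).ge
      have := (s2 c a).ge
      exact hex_edges a b c X Y Z (fun x y => (0 ≤ ori c a x ∧ 0 ≤ ori c a y) ∨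
        (0 ≤ ori c a x ∧ 0 ≤ ori c a y)) (by left; constructor <;> linarith)
        (by left; constructor <;> linarith) (by left; constructor <;> linarith)
        (by left; constructor <;> linarith) (by left; constructor <;> linarith)
        (by left; constructor <;> linarith)

lemma core_min (S : Set Pt) (hfin : S.Finite) (hgp : GenPos S) (a b c : Pt) (ha : a ∈ S)
    (hb : b ∈ S) (hc : c ∈ S) (hD : 0 < ori a b c) (h3 : 3 ≤ cnt S a b c)
    (hmin : ∀ a' ∈ S, ∀ b' ∈ S, ∀ c' ∈ S, 0 < ori a' b' c' → 3 ≤ cnt S a' b' c' →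
      cnt S a b c ≤ cnt S a' b' c') :
    ∃ v : ZMod 6 → Pt, Set.range v ⊆ S ∧ IsStandardPseudoTriangle 6 v ∧ EmptyIn 6 v S := by
  have gp : ∀ p ∈ S, ∀ q ∈ S, ∀ r ∈ S, p ≠ q → p ≠ r → q ≠ r → ori p q r ≠ 0 :=
    fun p hp q hq r hr n1 n2 n3 h => hgp p hp q hq r hr n1 n2 n3 (collinear_of_ori p q r n1 h)
  have hD2 : ori b c a = ori a b c := (ori_cyc a b c).symm
  have hD3 : ori c a b = ori a b c := (ori_cyc c a b)
  have f2 : {p ∈ S | Ins a b c p}.Finite := hfin.subset (Set.sep_subset _ _)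
  let I : Finset Pt := f2.toFinset
  have memI : ∀ p, p ∈ I ↔ p ∈ S ∧ Ins a b c p := by intro p; simp [I]
  have cardI : I.card = cnt S a b c := by
    unfold cnt; rw [Set.ncard_eq_toFinset_card _ f2]
  let u : Pt → ℝ := fun p => Real.log (ori a b p) - Real.log (ori b c p)
  let v : Pt → ℝ := fun p => Real.log (ori b c p) - Real.log (ori c a p)
  let w : Pt → ℝ := fun p => Real.log (ori c a p) - Real.log (ori a b p)
  have bu : ∀ p ∈ I, ∀ q ∈ I, (u p < u q ↔ ori b p q < 0) := by
    intro p hp q hq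
    have ip := ((memI p).1 hp).2
    have iq := ((memI q).1 hq).2
    exact br _ _ _ _ _ _ hD ip.1 ip.2.1 iq.1 iq.2.1 (ori_b a b c p q)
  have bv : ∀ p ∈ I, ∀ q ∈ I, (v p < v q ↔ ori c p q < 0) := by
    intro p hp q hq
    have ip := ((memI p).1 hp).2
    have iq := ((memI q).1 hq).2
    exact br _ _ _ _ _ _ hD ip.2.1 ip.2.2 iq.2.1 iq.2.2 (hD2 ▸ ori_b b c a p q)
  have bw : ∀ p ∈ I, ∀ q ∈ I, (w p < w q ↔ ori a p q < 0) := by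
    intro p hp q hq
    have ip := ((memI p).1 hp).2
    have iq := ((memI q).1 hq).2
    exact br _ _ _ _ _ _ hD ip.2.2 ip.1 iq.2.2 iq.1 (hD3 ▸ ori_b c a b p q)
  have na : ∀ p ∈ I, a ≠ p := by
    rintro p hp rfl
    have := ((memI _).1 hp).2.1
    rw [ori_self'] at this; exact lt_irrefl _ this
  have nb : ∀ p ∈ I, b ≠ p := by
    rintro p hp rfl
    have := ((memI _).1 hp).2.1
    rw [ori_self] at this; exact lt_irrefl _ this
  have nc : ∀ p ∈ I, c ≠ p := by
    rintro p hp rfl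
    have := ((memI _).1 hp).2.2.1
    rw [ori_self] at this; exact lt_irrefl _ this
  have inj : ∀ (d : Pt) (f : Pt → ℝ), d ∈ S → (∀ p ∈ I, d ≠ p) →
      (∀ p ∈ I, ∀ q ∈ I, (f p < f q ↔ ori d p q < 0)) →
      ∀ p ∈ I, ∀ q ∈ I, p ≠ q → f p ≠ f q := by
    intro d f hd nd hf p hp q hq hpq heq
    have := gp d hd p ((memI p).1 hp).1 q ((memI q).1 hq).1 (nd p hp) (nd q hq) hpq
    rcases lt_or_gt_of_ne this with h | h
    · exact absurd ((hf p hp q hq).2 h) (by rw [heq]; exact lt_irrefl _)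
    · rw [ori_swap] at h
      exact absurd ((hf q hq p hp).2 (by linarith)) (by rw [heq]; exact lt_irrefl _)
  have hu := inj b u hb nb bu
  have hv := inj c v hc nc bv
  have hw := inj a w ha na bw
  obtain ⟨X, hX, Y, hY, Z, hZ, h1, h2, h3, hcov⟩ := comb u v w
    (by intro p; simp only [u, v, w]; ring) I
    (by
      intro q hq P hP Q hQ R hR n1 n2 n3 i1 i2 i3
      have conv : ∀ P ∈ I, (u P < u q ∧ w q < w P) → Ins a b q P := by
        intro P hP i
        have j1 := (bu P hP q hq).1 i.1
        have j2 := (bw q hq P hP).1 i.2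
        refine ⟨((memI P).1 hP).2.1, ?_, ?_⟩
        · rw [ori_swap]; linarith
        · rw [ori_cyc, ori_swap]; linarith
      exact no_triple S hfin a b c ha hb hD hmin q ((memI q).1 hq).1 ((memI q).1 hq).2 P Q R
        ((memI P).1 hP).1 ((memI Q).1 hQ).1 ((memI R).1 hR).1 n1 n2 n3
        (conv P hP i1) (conv Q hQ i2) (conv R hR i3))
    (by
      intro q hq P hP Q hQ R hR n1 n2 n3 i1 i2 i3
      have conv : ∀ P ∈ I, (v P < v q ∧ u q < u P) → Ins b c q P := by
        intro P hP i
        have j1 := (bv P hP q hq).1 i.1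
        have j2 := (bu q hq P hP).1 i.2
        refine ⟨((memI P).1 hP).2.2.1, ?_, ?_⟩
        · rw [ori_swap]; linarith
        · rw [ori_cyc, ori_swap]; linarith
      exact no_triple S hfin b c a hb hc (by rw [hD2]; exact hD) (by rw [cnt_cyc]; exact hmin)
        q ((memI q).1 hq).1 ((Ins_cyc _ _ _ _).2 ((memI q).1 hq).2) P Q R
        ((memI P).1 hP).1 ((memI Q).1 hQ).1 ((memI R).1 hR).1 n1 n2 n3
        (conv P hP i1) (conv Q hQ i2) (conv R hR i3))
    (by
      intro q hq P hP Q hQ R hR n1 n2 n3 i1 i2 i3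
      have conv : ∀ P ∈ I, (w P < w q ∧ v q < v P) → Ins c a q P := by
        intro P hP i
        have j1 := (bw P hP q hq).1 i.1
        have j2 := (bv q hq P hP).1 i.2
        refine ⟨((memI P).1 hP).2.2.2, ?_, ?_⟩
        · rw [ori_swap]; linarith
        · rw [ori_cyc, ori_swap]; linarith
      exact no_triple S hfin c a b hc ha (by rw [hD3]; exact hD)
        (by rw [cnt_cyc, cnt_cyc]; exact hmin)
        q ((memI q).1 hq).1 ((Ins_cyc _ _ _ _).1 ((memI q).1 hq).2) P Q R
        ((memI P).1 hP).1 ((memI Q).1 hQ).1 ((memI R).1 hR).1 n1 n2 n3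
        (conv P hP i1) (conv Q hQ i2) (conv R hR i3))
    hu hv hw (by rw [cardI]; exact h3)
  have k1 := (bu X hX Y hY).1 h1
  have k2 := (bv Y hY Z hZ).1 h2
  have k3 := (bw Z hZ X hX).1 h3
  obtain ⟨SX, iX⟩ := (memI X).1 hX
  obtain ⟨SY, iY⟩ := (memI Y).1 hY
  obtain ⟨SZ, iZ⟩ := (memI Z).1 hZ
  refine ⟨hex a b c X Y Z, ?_, hex_std a b c X Y Z hD iX iY iZ k1 k2 k3, ?_⟩
  · rintro x ⟨i, rfl⟩
    exact hex_edges a b c X Y Z (fun x _ => x ∈ S) ha SX hb SY hc SZ i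
  · unfold EmptyIn
    rw [Set.eq_empty_iff_forall_notMem]
    rintro s ⟨hsI, hsS⟩
    have hnv : ∀ i, s ≠ hex a b c X Y Z i := by
      rintro i rfl
      exact hsI.1 (Set.mem_iUnion.2 ⟨i, left_mem_segment _ _ _⟩)
    have sa : s ≠ a := hnv 0
    have sX : s ≠ X := hnv 1
    have sb : s ≠ b := hnv 2
    have sY : s ≠ Y := hnv 3
    have sc : s ≠ c := hnv 4
    have sZ : s ≠ Z := hnv 5
    refine hex_empty a b c X Y Z s hD iX iY iZ k1 k2 k3 ?_ hsI
    by_cases hin : Ins a b c s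
    · have hs : s ∈ I := (memI s).2 ⟨hsS, hin⟩
      rcases hcov s hs with h | h | h
      · left
        exact ⟨(bu s hs X hX).1 (lt_of_le_of_ne h.1 (hu s hs X hX sX)),
          (bw X hX s hs).1 (lt_of_le_of_ne h.2 (hw X hX s hs sX.symm))⟩
      · right; left
        exact ⟨(bv s hs Y hY).1 (lt_of_le_of_ne h.1 (hv s hs Y hY sY)),
          (bu Y hY s hs).1 (lt_of_le_of_ne h.2 (hu Y hY s hs sY.symm))⟩
      · right; right; left
        exact ⟨(bw s hs Z hZ).1 (lt_of_le_of_ne h.1 (hw s hs Z hZ sZ)),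
          (bv Z hZ s hs).1 (lt_of_le_of_ne h.2 (hv Z hZ s hs sZ.symm))⟩
    · right; right; right
      have nab : a ≠ b := by rintro rfl; unfold ori at hD; linarith
      have nbc : b ≠ c := by rintro rfl; rw [ori_self] at hD; linarith
      have nca : c ≠ a := by rintro rfl; rw [ori_self'] at hD; linarith
      have o1 := gp a ha b hb s hsS nab sa.symm sb.symm
      have o2 := gp b hb c hc s hsS nbc sb.symm sc.symm
      have o3 := gp c hc a ha s hsS nca sc.symm sa.symm
      by_contra hcon
      simp only [not_or, not_lt] at hcon
      exact hin ⟨lt_of_le_of_ne hcon.1 o1.symm, lt_of_le_of_ne hcon.2.1 o2.symm,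
        lt_of_le_of_ne hcon.2.2 o3.symm⟩

lemma core (S : Set Pt) (hfin : S.Finite) (hgp : GenPos S) (a b c : Pt) (ha : a ∈ S)
    (hb : b ∈ S) (hc : c ∈ S) (hD : 0 < ori a b c) (h3 : 3 ≤ cnt S a b c) :
    ∃ v : ZMod 6 → Pt, Set.range v ⊆ S ∧ IsStandardPseudoTriangle 6 v ∧ EmptyIn 6 v S := by
  let T : Set (Pt × Pt × Pt) := {t | t.1 ∈ S ∧ t.2.1 ∈ S ∧ t.2.2 ∈ S ∧
    0 < ori t.1 t.2.1 t.2.2 ∧ 3 ≤ cnt S t.1 t.2.1 t.2.2}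
  obtain ⟨⟨a', b', c'⟩, ⟨k1, k2, k3, k4, k5⟩, hm⟩ := WellFounded.has_min
    (measure (fun t : Pt × Pt × Pt => cnt S t.1 t.2.1 t.2.2)).wf T ⟨(a, b, c), ha, hb, hc, hD, h3⟩
  refine core_min S hfin hgp a' b' c' k1 k2 k3 k4 k5 ?_
  intro x hx y hy z hz h1 h2
  exact not_lt.1 (hm (x, y, z) ⟨hx, hy, hz, h1, h2⟩)

lemma hull_sub (S : Set Pt) (hfin : S.Finite) :
    convexHull ℝ S ⊆ convexHull ℝ (hullVertices S) := by
  have hK : IsCompact (convexHull ℝ S) := hfin.isCompact_convexHull ℝ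
  have h1 := closure_convexHull_extremePoints hK (convex_convexHull ℝ S)
  have h2 : (convexHull ℝ S).extremePoints ℝ ⊆ hullVertices S := by
    intro p hp
    refine ⟨extremePoints_convexHull_subset hp, ?_⟩
    intro hmem
    have hc := ((convex_convexHull ℝ S).mem_extremePoints_iff_convex_diff.1 hp).2
    have : convexHull ℝ (S \ {p}) ⊆ convexHull ℝ S \ {p} :=
      convexHull_min (Set.diff_subset_diff_left (subset_convexHull ℝ S)) hc
    exact (this hmem).2 rfl
  have h3 : (hullVertices S).Finite := hfin.subset (Set.sep_subset _ _)
  rw [← h1]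
  exact closure_minimal (convexHull_mono h2) (h3.isClosed_convexHull ℝ)

lemma int_pos (K : Set Pt) (A B y p : Pt) (hK : ∀ x ∈ K, 0 ≤ ori A B x) (hy : 0 < ori A B y)
    (hp : p ∈ interior K) : 0 < ori A B p := by
  have hc : Continuous (fun t : ℝ => (1 + t) • p + (-t) • y) := by fun_prop
  have ht := (hc.tendsto' 0 p (by simp)).eventually (mem_interior_iff_mem_nhds.1 hp)
  have ht2 := (ht.filter_mono (nhdsWithin_le_nhds (s := Set.Ioi 0))).and self_mem_nhdsWithin
  obtain ⟨t, h1, h2⟩ := ht2.exists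
  have h2 : 0 < t := h2
  have := hK _ h1
  rw [ori_comb _ _ _ _ _ _ (by ring)] at this
  have h4 := mul_pos h2 hy
  have : 0 < (1 + t) * ori A B p := by linarith
  exact (mul_pos_iff_of_pos_left (by linarith)).1 this

lemma cnt_ge (S : Set Pt) (hfin : S.Finite) (a b c : Pt) (hD : 0 < ori a b c)
    (hsub : convexHull ℝ S ⊆ convexHull ℝ {a, b, c}) (hint : 3 ≤ (interiorPts S).ncard) :
    3 ≤ cnt S a b c := by
  have hD2 : ori b c a = ori a b c := (ori_cyc a b c).symm
  have hD3 : ori c a b = ori a b c := (ori_cyc c a b)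
  refine hint.trans (Set.ncard_le_ncard ?_ (hfin.subset (Set.sep_subset _ _)))
  rintro p ⟨hp, hpi⟩
  have half : ∀ A B : Pt, 0 ≤ ori A B a → 0 ≤ ori A B b → 0 ≤ ori A B c →
      ∀ x ∈ convexHull ℝ S, 0 ≤ ori A B x := by
    intro A B g1 g2 g3 x hx
    have : convexHull ℝ {a, b, c} ⊆ {x | 0 ≤ ori A B x} := by
      apply convexHull_min
      · rintro x (rfl | rfl | rfl) <;> assumption
      · intro x hx y hy α β hα hβ hab
        show 0 ≤ ori A B _
        rw [ori_comb _ _ _ _ _ _ hab]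
        exact add_nonneg (mul_nonneg hα hx) (mul_nonneg hβ hy)
    exact this (hsub hx)
  refine ⟨hp, ?_, ?_, ?_⟩
  · exact int_pos _ a b c p (half a b (ori_self' _ _).ge (ori_self _ _).ge hD.le) hD hpi
  · exact int_pos _ b c a p (half b c (by linarith) (ori_self' _ _).ge (ori_self _ _).ge)
      (by linarith) hpi
  · exact int_pos _ c a b p (half c a (ori_self _ _).ge (by linarith) (ori_self' _ _).ge)
      (by linarith) hpi

/-- a set in general position with triangular convex hull and at least
3 interior points contains an empty standard 6-pseudo-triangle. -/
theorem statement_3 (S : Set Pt) (hfin : S.Finite) (hgp : GenPos S)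
    (hhull : (hullVertices S).ncard = 3) (hint : 3 ≤ (interiorPts S).ncard) :
    ∃ v : ZMod 6 → Pt, Set.range v ⊆ S ∧ IsStandardPseudoTriangle 6 v ∧ EmptyIn 6 v S := by
  obtain ⟨a, b, c, nab, nac, nbc, heq⟩ := Set.ncard_eq_three.1 hhull
  have hsub := hull_sub S hfin
  rw [heq] at hsub
  have hin : ∀ x ∈ ({a, b, c} : Set Pt), x ∈ S := by
    intro x hx; rw [← heq] at hx; exact hx.1
  have ha : a ∈ S := hin a (by simp)
  have hb : b ∈ S := hin b (by simp)
  have hc : c ∈ S := hin c (by simp)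
  have h0 : ori a b c ≠ 0 := fun h =>
    hgp a ha b hb c hc nab nac nbc (collinear_of_ori a b c nab h)
  rcases lt_or_gt_of_ne h0 with h | h
  · have h' : 0 < ori a c b := by rw [ori_swap]; linarith
    refine core S hfin hgp a c b ha hc hb h' (cnt_ge S hfin a c b h' ?_ hint)
    rwa [Set.pair_comm c b]
  · exact core S hfin hgp a b c ha hb hc h (cnt_ge S hfin a b c h hsub hint)
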